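/- arXiv:1505.01972 — 3 statements merged into one kernel-verified Lean document; each statement's English description precedes it below -/
import Mathlib

section
/- Let T, T' be contractions on H that are orthogonal projections (T = T* = T², T' = T'* = T'²). Then T is Z-dominated by T' (i.e., there exists c > 0 with ‖D_T h‖ ≤ c‖D_{T'}h‖ and ‖(T'-T)h‖ ≤ c‖D_{T'}h‖ for all h) if and only if T' ≤ T in the Loewner order. -/
open ContinuousLinearMap

/-- The defect of an orthogonal projection `P`: `‖h‖² - ‖P h‖² = ‖h - P h‖²`. -/
theorem IsStarProjection.sqrt_norm_sq_sub_norm_apply_sq {𝕜 H : Type*} [RCLike 𝕜]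
    [NormedAddCommGroup H] [InnerProductSpace 𝕜 H] [CompleteSpace H] {P : H →L[𝕜] H}
    (hP : IsStarProjection P) (h : H) :
    Real.sqrt (‖h‖ ^ 2 - ‖P h‖ ^ 2) = ‖h - P h‖ := by
  have hPP : P (P h) = P h := DFunLike.congr_fun hP.isIdempotentElem.eq h
  have horth : inner 𝕜 (P h) (h - P h) = 0 := by
    rw [← adjoint_inner_right, hP.isSelfAdjoint.adjoint_eq, map_sub, hPP, sub_self,
      inner_zero_right]
  have hpyth := norm_add_sq_eq_norm_sq_add_norm_sq_of_inner_eq_zero (P h) (h - P h) horth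
  rw [add_sub_cancel] at hpyth
  rw [show ‖h‖ ^ 2 - ‖P h‖ ^ 2 = ‖h - P h‖ ^ 2 by linarith, Real.sqrt_sq (norm_nonneg _)]

/-- for orthogonal projections `T, T'`, Z-domination of `T` by `T'` is
equivalent to `T' ≤ T` in the Loewner order. -/
theorem z_domination_projections {H : Type*} [NormedAddCommGroup H] [InnerProductSpace ℂ H]
    [CompleteSpace H] (T T' : H →L[ℂ] H)
    (hTsa : adjoint T = T) (hTidem : T * T = T)
    (hT'sa : adjoint T' = T') (hT'idem : T' * T' = T')
    (hT : ‖T‖ ≤ 1) (hT' : ‖T'‖ ≤ 1) :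
    (∃ c : ℝ, 0 < c ∧
        (∀ h : H, Real.sqrt (‖h‖ ^ 2 - ‖T h‖ ^ 2) ≤ c * Real.sqrt (‖h‖ ^ 2 - ‖T' h‖ ^ 2)) ∧
        (∀ h : H, ‖(T' - T) h‖ ≤ c * Real.sqrt (‖h‖ ^ 2 - ‖T' h‖ ^ 2))) ↔
      (T - T').IsPositive := by
  have hP : IsStarProjection T := ⟨hTidem, hTsa⟩
  have hP' : IsStarProjection T' := ⟨hT'idem, hT'sa⟩
  simp only [hP.sqrt_norm_sq_sub_norm_apply_sq, hP'.sqrt_norm_sq_sub_norm_apply_sq]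
  rw [← ContinuousLinearMap.le_def, hP'.le_iff_mul_eq_right hP]
  constructor
  · rintro ⟨c, -, hdefect, -⟩
    ext k
    have hfix : T' (T' k) = T' k := DFunLike.congr_fun hT'idem k
    have hle := hdefect (T' k)
    rw [hfix, sub_self, norm_zero, mul_zero] at hle
    exact (sub_eq_zero.mp (norm_le_zero_iff.mp hle)).symm
  · intro hmul
    have happ (h : H) : T (T' h) = T' h := DFunLike.congr_fun hmul h
    refine ⟨1, one_pos, fun h => ?_, fun h => ?_⟩
    · have heq : h - T h = (1 - T) (h - T' h) := by simp [happ]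
      rw [heq]
      exact (1 - T).le_of_opNorm_le hP.one_sub.norm_le _
    · have heq : (T' - T) h = -T (h - T' h) := by simp [happ]
      rw [heq, norm_neg]
      exact T.le_of_opNorm_le hT _
end

section
/- Let U be multiplication by e^{it} on L²([0,2π], dm) (m normalized Lebesgue measure) and let ξ = 1 be the constant function. Define T = U - (Uξ ⊗ ξ), i.e., Tf = e^{it}f - ⟨f,1⟩e^{it}. Then for all f ∈ L² and all λ with |λ|<1: ‖(I - λU)⁻¹(U - T)f‖² ≤ (1/(1-|λ|²))·‖D_T f‖², where ‖D_T f‖² = |⟨f,1⟩|². -/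
open ContinuousLinearMap MeasureTheory

local notation "⟪" x ", " y "⟫" => @inner ℂ _ _ x y

/-- Normalized Lebesgue measure on `[0, 2π]`. -/
noncomputable def normLebesgue : Measure ℝ :=
  (ENNReal.ofReal (2 * Real.pi)⁻¹) • (volume.restrict (Set.Icc (0 : ℝ) (2 * Real.pi)))

/-- If `U` preserves inner products and `ξ` is orthogonal to every `U ^ (n + 1) ξ`, then a solution
of `g - lam • U g = U ξ` with `‖lam‖ < 1` is orthogonal to `ξ`. -/
lemma inner_eq_zero_of_resolvent_eq {H : Type*} [NormedAddCommGroup H] [InnerProductSpace ℂ H]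
    (U : H →L[ℂ] H) (hU : ∀ x, ‖U x‖ = ‖x‖) {ξ g : H} {lam : ℂ}
    (hξ : ∀ n : ℕ, inner ℂ ξ ((U ^ (n + 1)) ξ) = 0) (hlam : ‖lam‖ < 1)
    (hg : g - lam • U g = U ξ) : inner ℂ ξ g = 0 := by
  have hpow : ∀ n : ℕ, ‖(U ^ n) g‖ = ‖g‖ := by
    intro n
    induction n with
    | zero => simp
    | succ n ih => rw [pow_succ', mul_apply_eq_comp, hU, ih]
  have hrec : ∀ n : ℕ, inner ℂ ξ g = lam ^ n * inner ℂ ξ ((U ^ n) g) := by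
    intro n
    induction n with
    | zero => simp
    | succ n ih =>
      have hstep : (U ^ n) g = (U ^ (n + 1)) ξ + lam • (U ^ (n + 1)) g := by
        conv_lhs => rw [sub_eq_iff_eq_add.mp hg]
        rw [map_add, map_smul, pow_succ, mul_apply_eq_comp,
          mul_apply_eq_comp]
      rw [ih, hstep, inner_add_right, inner_smul_right, hξ]
      ring
  have hle : ∀ n : ℕ, ‖(inner ℂ ξ g : ℂ)‖ ≤ ‖lam‖ ^ n * (‖ξ‖ * ‖g‖) := by
    intro n
    rw [hrec n, norm_mul, norm_pow]
    gcongr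
    exact (norm_inner_le_norm _ _).trans_eq (by rw [hpow])
  have hlim := (tendsto_pow_atTop_nhds_zero_of_lt_one (norm_nonneg lam) hlam).mul_const (‖ξ‖ * ‖g‖)
  rw [zero_mul] at hlim
  exact norm_le_zero_iff.mp (ge_of_tendsto' hlim hle)

/-- For an inner-product-preserving `U`, and `ξ` orthogonal to every `U ^ (n + 1) ξ`, the vector
`(1 - lam • U)⁻¹ U ξ` has norm `‖ξ‖ / √(1 - ‖lam‖ ^ 2)`. -/
lemma norm_sq_resolvent_apply {H : Type*} [NormedAddCommGroup H] [InnerProductSpace ℂ H]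
    [CompleteSpace H] (U : H →L[ℂ] H) (hU : ∀ x y, inner ℂ (U x) (U y) = inner ℂ x y) {ξ : H}
    {lam : ℂ} (hξ : ∀ n : ℕ, inner ℂ ξ ((U ^ (n + 1)) ξ) = 0) (hlam : ‖lam‖ < 1) :
    ‖Ring.inverse (1 - lam • U) (U ξ)‖ ^ 2 = 1 / (1 - ‖lam‖ ^ 2) * ‖ξ‖ ^ 2 := by
  have hnorm : ∀ x, ‖U x‖ = ‖x‖ := by
    intro x
    rw [@norm_eq_sqrt_re_inner ℂ, hU, ← @norm_eq_sqrt_re_inner ℂ]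
  have hU1 : ‖U‖ ≤ 1 :=
    ContinuousLinearMap.opNorm_le_bound _ zero_le_one fun x => by rw [hnorm, one_mul]
  have hunit : IsUnit (1 - lam • U) := by
    apply isUnit_one_sub_of_norm_lt_one
    rw [norm_smul]
    exact (mul_le_of_le_one_right (norm_nonneg _) hU1).trans_lt hlam
  set g := Ring.inverse (1 - lam • U) (U ξ) with hgdef
  have hg : g - lam • U g = U ξ := by
    have h := DFunLike.congr_fun (Ring.mul_inverse_cancel _ hunit) (U ξ)
    simpa [mul_apply_eq_comp] using h
  have hortho := inner_eq_zero_of_resolvent_eq U hnorm hξ hlam hg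
  have hsum : ‖g‖ ^ 2 = ‖ξ‖ ^ 2 + ‖lam‖ ^ 2 * ‖g‖ ^ 2 := by
    have hcross : inner ℂ (U ξ) (lam • U g) = 0 := by rw [inner_smul_right, hU, hortho, mul_zero]
    have h := norm_add_sq_eq_norm_sq_add_norm_sq_of_inner_eq_zero (𝕜 := ℂ) _ _ hcross
    rw [← sub_eq_iff_eq_add.mp hg, norm_smul, hnorm, hnorm] at h
    linarith
  have hpos : 0 < 1 - ‖lam‖ ^ 2 := by nlinarith [norm_nonneg lam]
  rw [div_mul_eq_mul_div, one_mul, eq_div_iff hpos.ne']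
  linarith

lemma integral_normLebesgue (f : ℝ → ℂ) :
    ∫ t, f t ∂normLebesgue = (2 * Real.pi)⁻¹ • ∫ t in (0 : ℝ)..(2 * Real.pi), f t := by
  rw [normLebesgue, integral_smul_measure, ENNReal.toReal_ofReal (by positivity),
    integral_Icc_eq_integral_Ioc, intervalIntegral.integral_of_le (by positivity)]

lemma integral_exp_pow_normLebesgue (n : ℕ) :
    ∫ t : ℝ, Complex.exp (Complex.I * t) ^ (n + 1) ∂normLebesgue = 0 := by
  have hc : ((n + 1 : ℕ) : ℂ) * Complex.I ≠ 0 :=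
    mul_ne_zero (Nat.cast_ne_zero.mpr n.succ_ne_zero) Complex.I_ne_zero
  have hfun : ∀ t : ℝ, Complex.exp (Complex.I * t) ^ (n + 1) =
      Complex.exp (((n + 1 : ℕ) : ℂ) * Complex.I * t) := by
    intro t
    rw [← Complex.exp_nat_mul, mul_assoc]
  have hperiod : ((n + 1 : ℕ) : ℂ) * Complex.I * ((2 * Real.pi : ℝ) : ℂ) =
      ((n + 1 : ℕ) : ℂ) * (2 * Real.pi * Complex.I) := by
    push_cast
    ring
  simp_rw [integral_normLebesgue, hfun]
  rw [integral_exp_mul_complex hc, hperiod, Complex.exp_nat_mul_two_pi_mul_I]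
  simp

/-- for `U` multiplication by `e^{it}` on `L²([0,2π], dm)`, `ξ = 1` and
`T = U - Uξ ⊗ ξ`, the resolvent estimate
`‖(I-λU)⁻¹(U-T)f‖² ≤ (1/(1-|λ|²))·‖D_T f‖²` holds, where `‖D_T f‖² = |⟨f,1⟩|²`. -/
theorem shift_pert_resolvent_estimate
    (U T : Lp ℂ 2 normLebesgue →L[ℂ] Lp ℂ 2 normLebesgue)
    (ξ : Lp ℂ 2 normLebesgue) (hξ : (ξ : ℝ → ℂ) =ᵐ[normLebesgue] fun _ => (1 : ℂ))
    (hU : ∀ f : Lp ℂ 2 normLebesgue,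
      (U f : ℝ → ℂ) =ᵐ[normLebesgue] fun t => Complex.exp (Complex.I * t) * f t)
    (hT : ∀ f : Lp ℂ 2 normLebesgue, T f = U f - ⟪ξ, f⟫ • U ξ) :
    ∀ f : Lp ℂ 2 normLebesgue, ∀ lam : ℂ, ‖lam‖ < 1 →
      ‖Ring.inverse (1 - lam • U) ((U - T) f)‖ ^ 2 ≤
        1 / (1 - ‖lam‖ ^ 2) * ‖⟪ξ, f⟫‖ ^ 2 := by
  have hinner : ∀ x y, (inner ℂ (U x) (U y) : ℂ) = inner ℂ x y := by
    intro x y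
    rw [L2.inner_def, L2.inner_def]
    refine integral_congr_ae ?_
    filter_upwards [hU x, hU y] with t hx hy
    have hexp : ‖Complex.exp (Complex.I * t)‖ = 1 := by
      rw [mul_comm, Complex.norm_exp_ofReal_mul_I]
    simp only [hx, hy, RCLike.inner_apply, map_mul]
    rw [mul_mul_mul_comm, Complex.mul_conj', hexp]
    simp
  have hpow : ∀ n : ℕ, ((U ^ n) ξ : ℝ → ℂ) =ᵐ[normLebesgue]
      fun t => Complex.exp (Complex.I * t) ^ n := by
    intro n
    induction n with
    | zero => simpa using hξ
    | succ n ih =>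
      rw [pow_succ', mul_apply_eq_comp]
      filter_upwards [hU ((U ^ n) ξ), ih] with t h1 h2
      rw [h1, h2, pow_succ']
  have hinnerξ : ∀ n : ℕ, (inner ℂ ξ ((U ^ n) ξ) : ℂ) =
      ∫ t : ℝ, Complex.exp (Complex.I * t) ^ n ∂normLebesgue := by
    intro n
    rw [L2.inner_def]
    refine integral_congr_ae ?_
    filter_upwards [hξ, hpow n] with t h1 h2
    rw [h1, h2]
    simp
  have hortho : ∀ n : ℕ, (inner ℂ ξ ((U ^ (n + 1)) ξ) : ℂ) = 0 := fun n => by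
    rw [hinnerξ, integral_exp_pow_normLebesgue]
  have hnorm : ‖ξ‖ ^ 2 = 1 := by
    have h := hinnerξ 0
    simp only [pow_zero, integral_normLebesgue] at h
    rw [one_apply_eq_self, inner_self_eq_norm_sq_to_K] at h
    have hpi : (Real.pi : ℂ) ≠ 0 := Complex.ofReal_ne_zero.mpr Real.pi_ne_zero
    have h' : ((‖ξ‖ : ℝ) : ℂ) ^ 2 = 1 := by
      refine h.trans ?_
      simp
      field_simp
    exact_mod_cast h'
  intro f lam hlam
  have hdiff : (U - T) f = (inner ℂ ξ f : ℂ) • U ξ := by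
    rw [sub_apply, hT, sub_sub_cancel]
  rw [hdiff, map_smul, norm_smul, mul_pow, norm_sq_resolvent_apply U hinner hortho hlam, hnorm,
    mul_one, mul_comm]
end

section
/- Let S be the unilateral shift on ℓ²(ℕ, E) (E a Hilbert space) and let A be a contraction on E. Define T' on ℓ²(ℕ, E) by T'(x₀, x₁, x₂, ...) = (0, Ax₀, x₁, x₂, ...). Then S satisfies the resolvent estimate ‖(I - λS)⁻¹(S - T')x‖² ≤ K/(1-|λ|²)·(‖x‖² - ‖T'x‖²) for all x and all |λ| < 1 if and only if A is a Halperin contraction, i.e., there exists K ≥ 0 such that ‖x₀ - Ax₀‖² ≤ K(‖x₀‖² - ‖Ax₀‖²) for all x₀ ∈ E. -/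
open ContinuousLinearMap

section

variable {E : Type*} [NormedAddCommGroup E]

theorem lp.hasSum_norm_sq {ι : Type*} (x : lp (fun _ : ι => E) 2) :
    HasSum (fun i => ‖x i‖ ^ 2) (‖x‖ ^ 2) := by
  simpa using lp.hasSum_norm (p := 2) (by norm_num) x

/-- The squared `ℓ²` norm splits into the head and the tail. -/
theorem lp.hasSum_norm_sq_tail (x : lp (fun _ : ℕ => E) 2) :
    HasSum (fun n => ‖x (n + 1)‖ ^ 2) (‖x‖ ^ 2 - ‖x 0‖ ^ 2) := by
  rw [hasSum_nat_add_iff (f := fun n => ‖x n‖ ^ 2) 1]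
  simpa using lp.hasSum_norm_sq x

variable [InnerProductSpace ℂ E]

theorem norm_unilateralShift_le_one
    {S : lp (fun _ : ℕ => E) 2 →L[ℂ] lp (fun _ : ℕ => E) 2}
    (hS0 : ∀ x : lp (fun _ : ℕ => E) 2, S x 0 = 0)
    (hSsucc : ∀ (x : lp (fun _ : ℕ => E) 2) (n : ℕ), S x (n + 1) = x n) : ‖S‖ ≤ 1 := by
  refine S.opNorm_le_bound zero_le_one fun x => ?_
  have h := lp.hasSum_norm_sq_tail (S x)
  simp only [hSsucc, hS0, norm_zero] at h
  have h' := h.unique (lp.hasSum_norm_sq x)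
  rw [one_mul]
  exact le_of_sq_le_sq (by linarith) (norm_nonneg x)

theorem norm_sq_sub_norm_sq_of_weightedShift {A : E →L[ℂ] E}
    {T' : lp (fun _ : ℕ => E) 2 →L[ℂ] lp (fun _ : ℕ => E) 2}
    (hT'0 : ∀ x : lp (fun _ : ℕ => E) 2, T' x 0 = 0)
    (hT'1 : ∀ x : lp (fun _ : ℕ => E) 2, T' x 1 = A (x 0))
    (hT'succ : ∀ (x : lp (fun _ : ℕ => E) 2) (n : ℕ), T' x (n + 2) = x (n + 1))
    (x : lp (fun _ : ℕ => E) 2) :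
    ‖x‖ ^ 2 - ‖T' x‖ ^ 2 = ‖x 0‖ ^ 2 - ‖A (x 0)‖ ^ 2 := by
  have h : HasSum (fun n => ‖T' x (n + 2)‖ ^ 2) (‖T' x‖ ^ 2 - ‖A (x 0)‖ ^ 2) := by
    rw [hasSum_nat_add_iff (f := fun n => ‖T' x n‖ ^ 2) 2]
    simpa [Finset.sum_range_succ, hT'0, hT'1] using lp.hasSum_norm_sq (T' x)
  simp only [hT'succ] at h
  have := h.unique (lp.hasSum_norm_sq_tail x)
  linarith

/-- If `(I - λS) u = (0, d, 0, 0, …)`, then `u = (0, d, λd, λ²d, …)`, which gives its norm. -/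
theorem norm_sq_of_one_sub_smul_shift_apply
    {S : lp (fun _ : ℕ => E) 2 →L[ℂ] lp (fun _ : ℕ => E) 2}
    (hS0 : ∀ x : lp (fun _ : ℕ => E) 2, S x 0 = 0)
    (hSsucc : ∀ (x : lp (fun _ : ℕ => E) 2) (n : ℕ), S x (n + 1) = x n)
    {lam : ℂ} (hlam : ‖lam‖ < 1) {u y : lp (fun _ : ℕ => E) 2}
    (hu : (1 - lam • S) u = y) (hy0 : y 0 = 0) (hy : ∀ n, y (n + 2) = 0) :
    ‖u‖ ^ 2 = ‖y 1‖ ^ 2 / (1 - ‖lam‖ ^ 2) := by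
  have hcoord (n : ℕ) : u n - lam • S u n = y n := by
    rw [← hu]; rfl
  have hu0 : u 0 = 0 := by simpa [hS0, hy0] using hcoord 0
  have husucc (n : ℕ) : u (n + 1) = lam ^ n • y 1 := by
    induction n with
    | zero => simpa [hSsucc, hu0] using hcoord 1
    | succ n ih =>
      have h := hcoord (n + 2)
      rw [hSsucc u (n + 1), hy, ih, sub_eq_zero] at h
      rw [h, smul_smul, pow_succ']
  have h := lp.hasSum_norm_sq_tail u
  simp only [husucc, hu0, norm_zero, norm_smul, norm_pow, mul_pow, ← pow_mul,
    mul_comm _ 2] at h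
  have hgeom := (hasSum_geometric_of_lt_one (r := ‖lam‖ ^ 2) (by positivity)
    (pow_lt_one₀ (norm_nonneg _) hlam two_ne_zero)).mul_right (‖y 1‖ ^ 2)
  simp only [← pow_mul] at hgeom
  have := h.unique hgeom
  rw [div_eq_inv_mul, ← this]
  ring

theorem norm_sq_resolvent_shift_sub [CompleteSpace E] {A : E →L[ℂ] E}
    {S T' : lp (fun _ : ℕ => E) 2 →L[ℂ] lp (fun _ : ℕ => E) 2}
    (hS0 : ∀ x : lp (fun _ : ℕ => E) 2, S x 0 = 0)
    (hSsucc : ∀ (x : lp (fun _ : ℕ => E) 2) (n : ℕ), S x (n + 1) = x n)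
    (hT'0 : ∀ x : lp (fun _ : ℕ => E) 2, T' x 0 = 0)
    (hT'1 : ∀ x : lp (fun _ : ℕ => E) 2, T' x 1 = A (x 0))
    (hT'succ : ∀ (x : lp (fun _ : ℕ => E) 2) (n : ℕ), T' x (n + 2) = x (n + 1))
    (x : lp (fun _ : ℕ => E) 2) {lam : ℂ} (hlam : ‖lam‖ < 1) :
    ‖Ring.inverse (1 - lam • S) ((S - T') x)‖ ^ 2 =
      ‖x 0 - A (x 0)‖ ^ 2 / (1 - ‖lam‖ ^ 2) := by
  have hnorm : ‖lam • S‖ < 1 := by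
    rw [norm_smul]
    exact (mul_le_of_le_one_right (norm_nonneg _)
      (norm_unilateralShift_le_one hS0 hSsucc)).trans_lt hlam
  have hinv := Ring.mul_inverse_cancel _ (isUnit_one_sub_of_norm_lt_one hnorm)
  have hcoord (n : ℕ) : (S - T') x n = S x n - T' x n := rfl
  have h := norm_sq_of_one_sub_smul_shift_apply hS0 hSsucc hlam
    (u := Ring.inverse (1 - lam • S) ((S - T') x)) (y := (S - T') x)
    (congrArg (· ((S - T') x)) hinv)
    (by rw [hcoord, hS0, hT'0, sub_zero])
    (fun n => by rw [hcoord, hSsucc x (n + 1), hT'succ, sub_self])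
  rwa [hcoord, hSsucc x 0, hT'1] at h

end

/-- for the unilateral shift `S` on `ℓ²(ℕ, E)` and the perturbation
`T'(x₀,x₁,...) = (0, Ax₀, x₁, ...)`, the resolvent estimate
`‖(I-λS)⁻¹(S-T')x‖² ≤ K/(1-|λ|²)·(‖x‖²-‖T'x‖²)` holds (for some `K` and all `x`, `λ ∈ 𝔻`)
iff `A` is a Halperin contraction. -/
theorem shift_halperin_resolvent {E : Type*} [NormedAddCommGroup E] [InnerProductSpace ℂ E]
    [CompleteSpace E] (A : E →L[ℂ] E) (hA : ‖A‖ ≤ 1)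
    (S T' : lp (fun _ : ℕ => E) 2 →L[ℂ] lp (fun _ : ℕ => E) 2)
    (hS0 : ∀ x : lp (fun _ : ℕ => E) 2, S x 0 = 0)
    (hSsucc : ∀ (x : lp (fun _ : ℕ => E) 2) (n : ℕ), S x (n + 1) = x n)
    (hT'0 : ∀ x : lp (fun _ : ℕ => E) 2, T' x 0 = 0)
    (hT'1 : ∀ x : lp (fun _ : ℕ => E) 2, T' x 1 = A (x 0))
    (hT'succ : ∀ (x : lp (fun _ : ℕ => E) 2) (n : ℕ), T' x (n + 2) = x (n + 1)) :
    (∃ K : ℝ, 0 ≤ K ∧ ∀ (x : lp (fun _ : ℕ => E) 2) (lam : ℂ), ‖lam‖ < 1 →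
        ‖Ring.inverse (1 - lam • S) ((S - T') x)‖ ^ 2 ≤
          K / (1 - ‖lam‖ ^ 2) * (‖x‖ ^ 2 - ‖T' x‖ ^ 2)) ↔
      (∃ K : ℝ, 0 ≤ K ∧ ∀ x₀ : E, ‖x₀ - A x₀‖ ^ 2 ≤ K * (‖x₀‖ ^ 2 - ‖A x₀‖ ^ 2)) := by
  constructor
  · rintro ⟨K, hK, h⟩
    refine ⟨K, hK, fun x₀ => ?_⟩
    have h0 := h (lp.single 2 0 x₀) 0 (by simp)
    rw [norm_sq_resolvent_shift_sub hS0 hSsucc hT'0 hT'1 hT'succ _ (by simp),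
      norm_sq_sub_norm_sq_of_weightedShift hT'0 hT'1 hT'succ] at h0
    simpa using h0
  · rintro ⟨K, hK, h⟩
    refine ⟨K, hK, fun x lam hlam => ?_⟩
    rw [norm_sq_resolvent_shift_sub hS0 hSsucc hT'0 hT'1 hT'succ _ hlam,
      norm_sq_sub_norm_sq_of_weightedShift hT'0 hT'1 hT'succ, div_mul_eq_mul_div]
    have : 0 ≤ 1 - ‖lam‖ ^ 2 :=
      sub_nonneg.2 (pow_le_one₀ (norm_nonneg _) hlam.le)
    gcongr
    exact h (x 0)
end
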